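/- Alignment interpretation of B-cos dynamic weights: let W ∈ ℝ^{q×p}, B > 1, j ∈ {1,…,q} with w_j ≠ 0, and x ∈ ℝ^p. Then the Euclidean norm of the j-th row of the B-cos dynamic weight matrix W̃_{(W,B)}(x) equals |c(x, ŵ_j)|^{B−1} and lies in [0,1]; it equals 0 if and only if x = 0 or ⟨x, w_j⟩ = 0, and it equals 1 if and only if x is a nonzero scalar multiple of w_j. -/

import Mathlib

open scoped Classical

noncomputable section BcosGNN

/-- Euclidean norm of a vector in `ℝ^p`. -/
def vnorm {p : ℕ} (x : Fin p → ℝ) : ℝ := Real.sqrt (∑ i, x i ^ 2)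

/-- Euclidean inner product on `ℝ^p`. -/
def vdot {p : ℕ} (x w : Fin p → ℝ) : ℝ := ∑ i, x i * w i

/-- Cosine similarity: `⟨x,w⟩ / (‖x‖‖w‖)` if both are nonzero, `0` otherwise. -/
def cosSim {p : ℕ} (x w : Fin p → ℝ) : ℝ :=
  if x ≠ 0 ∧ w ≠ 0 then vdot x w / (vnorm x * vnorm w) else 0

/-- Hat operator: `ŵ = w / ‖w‖` if `w ≠ 0`, else `0`. -/
def hatVec {p : ℕ} (w : Fin p → ℝ) : Fin p → ℝ :=
  if w ≠ 0 then (vnorm w)⁻¹ • w else 0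

/-- The B-cos transform `f_{(W,B)} : ℝ^p → ℝ^q`, defined coordinatewise by
`f_{(W,B)}(x)_j = ‖ŵ_j‖·‖x‖·|c(x,ŵ_j)|^B·sgn(c(x,ŵ_j))` (real powers). -/
def bcos {q p : ℕ} (W : Matrix (Fin q) (Fin p) ℝ) (B : ℝ) (x : Fin p → ℝ) :
    Fin q → ℝ :=
  fun j =>
    vnorm (hatVec (W j)) * vnorm x * |cosSim x (hatVec (W j))| ^ B *
      Real.sign (cosSim x (hatVec (W j)))

/-- The B-cos dynamic weight matrix: its `j`-th row is `|c(x,ŵ_j)|^{B-1} · ŵ_j`. -/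
def bcosDynW {q p : ℕ} (W : Matrix (Fin q) (Fin p) ℝ) (B : ℝ) (x : Fin p → ℝ) :
    Matrix (Fin q) (Fin p) ℝ :=
  fun j i => |cosSim x (hatVec (W j))| ^ (B - 1) * hatVec (W j) i

open scoped RealInnerProductSpace in
theorem vdot_eq_inner {p : ℕ} (x w : Fin p → ℝ) :
    vdot x w = ⟪WithLp.toLp 2 x, WithLp.toLp 2 w⟫ := by
  simp [vdot, PiLp.inner_apply, mul_comm]

theorem vnorm_eq_norm {p : ℕ} (x : Fin p → ℝ) : vnorm x = ‖WithLp.toLp 2 x‖ := by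
  simp [vnorm, EuclideanSpace.norm_eq]

theorem vnorm_nonneg {p : ℕ} (x : Fin p → ℝ) : 0 ≤ vnorm x :=
  Real.sqrt_nonneg _

theorem vnorm_eq_zero {p : ℕ} {x : Fin p → ℝ} : vnorm x = 0 ↔ x = 0 := by
  simp [vnorm_eq_norm]

theorem vnorm_smul {p : ℕ} (a : ℝ) (x : Fin p → ℝ) : vnorm (a • x) = |a| * vnorm x := by
  simp [vnorm_eq_norm, norm_smul]

theorem vdot_smul_right {p : ℕ} (a : ℝ) (x w : Fin p → ℝ) :
    vdot x (a • w) = a * vdot x w := by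
  simp [vdot_eq_inner, real_inner_smul_right]

theorem cosSim_eq_div {p : ℕ} (x w : Fin p → ℝ) :
    cosSim x w = vdot x w / (vnorm x * vnorm w) := by
  unfold cosSim
  split_ifs with h
  · rfl
  · rcases not_and_or.mp h with h | h <;> simp [vnorm_eq_zero.mpr (not_not.mp h)]

theorem vnorm_hatVec {p : ℕ} {w : Fin p → ℝ} (hw : w ≠ 0) : vnorm (hatVec w) = 1 := by
  have h : vnorm w ≠ 0 := vnorm_eq_zero.not.mpr hw
  rw [hatVec, if_pos hw, vnorm_smul, abs_inv, abs_of_nonneg (vnorm_nonneg w),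
    inv_mul_cancel₀ h]

theorem cosSim_hatVec {p : ℕ} (x w : Fin p → ℝ) : cosSim x (hatVec w) = cosSim x w := by
  by_cases hw : w = 0
  · simp [hatVec, hw]
  · rw [cosSim_eq_div, cosSim_eq_div, vnorm_hatVec hw, hatVec, if_pos hw, vdot_smul_right,
      mul_one, mul_comm (vnorm x), ← div_div, inv_mul_eq_div]

theorem abs_cosSim_le_one {p : ℕ} (x w : Fin p → ℝ) : |cosSim x w| ≤ 1 := by
  rw [cosSim_eq_div, vdot_eq_inner, vnorm_eq_norm, vnorm_eq_norm]
  exact abs_real_inner_div_norm_mul_norm_le_one _ _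

theorem cosSim_eq_zero_iff {p : ℕ} {x w : Fin p → ℝ} (hw : w ≠ 0) :
    cosSim x w = 0 ↔ x = 0 ∨ vdot x w = 0 := by
  simp [cosSim_eq_div, vnorm_eq_zero, hw, or_comm]

theorem abs_cosSim_eq_one_iff {p : ℕ} {x w : Fin p → ℝ} (hw : w ≠ 0) :
    |cosSim x w| = 1 ↔ ∃ l : ℝ, l ≠ 0 ∧ x = l • w := by
  rw [cosSim_eq_div, vdot_eq_inner, vnorm_eq_norm, vnorm_eq_norm, real_inner_comm,
    mul_comm ‖_‖, abs_real_inner_div_norm_mul_norm_eq_one_iff]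
  simp [hw, ← WithLp.toLp_smul]

theorem vnorm_bcosDynW_row {q p : ℕ} (W : Matrix (Fin q) (Fin p) ℝ) (B : ℝ) {j : Fin q}
    (hw : W j ≠ 0) (x : Fin p → ℝ) :
    vnorm (bcosDynW W B x j) = |cosSim x (hatVec (W j))| ^ (B - 1) := by
  have h : bcosDynW W B x j = |cosSim x (hatVec (W j))| ^ (B - 1) • hatVec (W j) := rfl
  rw [h, vnorm_smul, vnorm_hatVec hw, mul_one, abs_of_nonneg (by positivity)]

/-- **Alignment interpretation of B-cos dynamic weights**: for `B > 1` and `w_j ≠ 0`,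
the Euclidean norm of the `j`-th row of `W̃_{(W,B)}(x)` equals `|c(x,ŵ_j)|^{B−1}`,
lies in `[0,1]`, vanishes iff `x = 0` or `⟨x, w_j⟩ = 0`, and equals `1` iff `x` is a
nonzero scalar multiple of `w_j`. -/
theorem bcosDynW_row_alignment {q p : ℕ} (W : Matrix (Fin q) (Fin p) ℝ) (B : ℝ)
    (hB : 1 < B) (j : Fin q) (hw : W j ≠ 0) (x : Fin p → ℝ) :
    vnorm (bcosDynW W B x j) = |cosSim x (hatVec (W j))| ^ (B - 1) ∧
      0 ≤ vnorm (bcosDynW W B x j) ∧ vnorm (bcosDynW W B x j) ≤ 1 ∧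
      (vnorm (bcosDynW W B x j) = 0 ↔ x = 0 ∨ vdot x (W j) = 0) ∧
      (vnorm (bcosDynW W B x j) = 1 ↔ ∃ l : ℝ, l ≠ 0 ∧ x = l • W j) := by
  have hB' : 0 < B - 1 := sub_pos.mpr hB
  have h0 := abs_nonneg (cosSim x (W j))
  refine ⟨vnorm_bcosDynW_row W B hw x, vnorm_nonneg _, ?_⟩
  rw [vnorm_bcosDynW_row W B hw x, cosSim_hatVec]
  refine ⟨Real.rpow_le_one h0 (abs_cosSim_le_one x (W j)) hB'.le, ?_, ?_⟩
  · rw [Real.rpow_eq_zero h0 hB'.ne', abs_eq_zero, cosSim_eq_zero_iff hw]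
  · rw [← abs_cosSim_eq_one_iff hw, ← Real.rpow_left_inj h0 zero_le_one hB'.ne', Real.one_rpow]

end BcosGNN
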